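/- (Three Rules Corollary) In a regular run, for every track x with significant moments 0 = t_0 < t_1 < t_2 < …: (a) Deadline(x,t+) ≠ Deadline(x,t) with Deadline(x,t+) = t + WaitTime holds exactly at the moments t = t_{3i+1}, i.e., exactly when TrackStatus(x,·) becomes coming; (b) Deadline(x,t) = t holds exactly at the moments t = t_{3i+1} + WaitTime; (c) Deadline(x,t+) ≠ Deadline(x,t) with Deadline(x,t+) = ∞ holds exactly at the moments t = t_{3i} with i > 0, i.e., exactly when TrackStatus(x,·) becomes empty. -/

import Mathlib

namespace RailCross

inductive TStat : Type
  | emp | coming | incrossing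
deriving DecidableEq

inductive DirV : Type
  | opn | cls
deriving DecidableEq

inductive GateV : Type
  | opened | closed
deriving DecidableEq

/-- `f` is piecewise constant on `[0, ∞)`: for every `τ > 0` there is a finite
partition `0 = s 0 < s 1 < … < s n = τ` such that `f` is constant on each open
subinterval `(s i, s (i+1))`. -/
def PWC {Y : Type*} (f : ℝ → Y) : Prop :=
  ∀ τ : ℝ, 0 < τ → ∃ n : ℕ, ∃ s : ℕ → ℝ,
    s 0 = 0 ∧ s n = τ ∧ (∀ i < n, s i < s (i + 1)) ∧
    (∀ i < n, ∀ a b : ℝ, s i < a → a < b → b < s (i + 1) → f a = f b)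

/-- `v` is the right-hand value `f(t+)`: `f` is constantly `v` on some `(t, t+ε)`. -/
def RightVal {Y : Type*} (f : ℝ → Y) (t : ℝ) (v : Y) : Prop :=
  ∃ ε : ℝ, 0 < ε ∧ ∀ u : ℝ, t < u → u < t + ε → f u = v

/-- `v` is the left-hand value `f(t−)` (for `t > 0`): `f` is constantly `v` on some `(t-ε, t)`. -/
def LeftVal {Y : Type*} (f : ℝ → Y) (t : ℝ) (v : Y) : Prop :=
  ∃ ε : ℝ, 0 < ε ∧ ε ≤ t ∧ ∀ u : ℝ, t - ε < u → u < t → f u = v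

/-- `tm` is the (finite or infinite) increasing sequence of significant moments of a
track with status function `f`; a finite sequence is encoded by letting `tm` take the
value `⊤ = ∞` from some point on. -/
structure TrainMotion (dmin dmax : ℝ) (f : ℝ → TStat) (tm : ℕ → EReal) : Prop where
  zero : tm 0 = 0
  mono : Monotone tm
  strict : ∀ i, tm i ≠ ⊤ → tm i < tm (i + 1)
  last_div : ∀ k, tm k ≠ ⊤ → tm (k + 1) = ⊤ → 3 ∣ k
  status_empty : ∀ i : ℕ, ∀ u : ℝ, tm (3 * i) ≤ (u : EReal) → (u : EReal) < tm (3 * i + 1) →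
    f u = TStat.emp
  status_coming : ∀ i : ℕ, ∀ u : ℝ, tm (3 * i + 1) ≤ (u : EReal) → (u : EReal) < tm (3 * i + 2) →
    f u = TStat.coming
  status_cross : ∀ i : ℕ, ∀ u : ℝ, tm (3 * i + 2) ≤ (u : EReal) → (u : EReal) < tm (3 * i + 3) →
    f u = TStat.incrossing
  gap : ∀ i : ℕ, ∀ a b : ℝ, tm (3 * i + 1) = (a : EReal) → tm (3 * i + 2) = (b : EReal) →
    dmin ≤ b - a ∧ b - a ≤ dmax

/-- `SafeToOpen(t)`: every track is empty or its deadline is more than `dopen` away. -/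
def SafeToOpen {Tracks : Type*} (dopen : ℝ) (trackStatus : Tracks → ℝ → TStat)
    (deadline : Tracks → ℝ → EReal) (t : ℝ) : Prop :=
  ∀ x : Tracks, trackStatus x t = TStat.emp ∨ ((t + dopen : ℝ) : EReal) < deadline x t

/-- A regular run of the railroad-crossing evolving algebra.  `WaitTime = dmin - dclose`. -/
structure RegularRun (Tracks : Type*) (dmin dmax dopen dclose : ℝ) where
  trackStatus : Tracks → ℝ → TStat
  deadline : Tracks → ℝ → EReal
  dir : ℝ → DirV
  gate : ℝ → GateV
  /-- the right-hand value `Deadline(x, t+)` -/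
  deadlinePlus : Tracks → ℝ → EReal
  /-- the right-hand value `Dir(t+)` -/
  dirPlus : ℝ → DirV
  /-- the right-hand value `GateStatus(t+)` -/
  gatePlus : ℝ → GateV
  pwc_ts : ∀ x, PWC (trackStatus x)
  pwc_dl : ∀ x, PWC (deadline x)
  pwc_dir : PWC dir
  pwc_gate : PWC gate
  dlPlus_spec : ∀ x, ∀ t : ℝ, 0 ≤ t → RightVal (deadline x) t (deadlinePlus x t)
  dirPlus_spec : ∀ t : ℝ, 0 ≤ t → RightVal dir t (dirPlus t)
  gatePlus_spec : ∀ t : ℝ, 0 ≤ t → RightVal gate t (gatePlus t)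
  dl_left : ∀ x, ∀ t : ℝ, 0 < t → LeftVal (deadline x) t (deadline x t)
  dir_left : ∀ t : ℝ, 0 < t → LeftVal dir t (dir t)
  gate_left : ∀ t : ℝ, 0 < t → LeftVal gate t (gate t)
  trainMotion : ∀ x, ∃ tm : ℕ → EReal, TrainMotion dmin dmax (trackStatus x) tm
  dl_init : ∀ x, deadline x 0 = ⊤
  dir_init : dir 0 = DirV.opn
  gate_init : gate 0 = GateV.opened
  dl_step_coming : ∀ x, ∀ t : ℝ, 0 ≤ t → trackStatus x t = TStat.coming → deadline x t = ⊤ →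
    deadlinePlus x t = ((t + (dmin - dclose) : ℝ) : EReal)
  dl_step_empty : ∀ x, ∀ t : ℝ, 0 ≤ t → trackStatus x t = TStat.emp → deadline x t ≠ ⊤ →
    deadlinePlus x t = ⊤
  dl_step_other : ∀ x, ∀ t : ℝ, 0 ≤ t →
    ¬(trackStatus x t = TStat.coming ∧ deadline x t = ⊤) →
    ¬(trackStatus x t = TStat.emp ∧ deadline x t ≠ ⊤) →
    deadlinePlus x t = deadline x t
  dir_step_close : ∀ t : ℝ, 0 ≤ t → (∃ x, deadline x t = (t : EReal)) → dirPlus t = DirV.cls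
  dir_step_open : ∀ t : ℝ, 0 ≤ t → (∀ x, deadline x t ≠ (t : EReal)) → dir t = DirV.cls →
    SafeToOpen dopen trackStatus deadline t → dirPlus t = DirV.opn
  dir_step_other : ∀ t : ℝ, 0 ≤ t → (∀ x, deadline x t ≠ (t : EReal)) →
    ¬(dir t = DirV.cls ∧ SafeToOpen dopen trackStatus deadline t) → dirPlus t = dir t
  gate_step : ∀ t : ℝ, 0 ≤ t →
    gatePlus t = gate t ∨ (dir t = DirV.opn ∧ gatePlus t = GateV.opened) ∨
      (dir t = DirV.cls ∧ gatePlus t = GateV.closed)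
  gate_close_bound : ∀ t : ℝ, 0 ≤ t →
    ¬(∀ u ∈ Set.Ioo t (t + dclose), dir u = DirV.cls ∧ gate u = GateV.opened)
  gate_open_bound : ∀ t : ℝ, 0 ≤ t →
    ¬(∀ u ∈ Set.Ioo t (t + dopen), dir u = DirV.opn ∧ gate u = GateV.closed)

/-- A left-continuous function with right-hand values `g` that equals `v` just after `a`
and is never made to leave `v` before `u` still equals `v` at `u`. -/
theorem eq_of_rightVal_eq {Y : Type*} {f g : ℝ → Y} {v : Y} {a u : ℝ}
    (hr : ∀ t : ℝ, 0 ≤ t → RightVal f t (g t)) (hl : ∀ t : ℝ, 0 < t → LeftVal f t (f t))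
    (ha : 0 ≤ a) (hga : g a = v) (hstep : ∀ t : ℝ, a < t → t < u → f t = v → g t = v)
    (hau : a < u) : f u = v := by
  by_contra hne
  set S : Set ℝ := {t | a < t ∧ t ≤ u ∧ f t ≠ v} with hS
  have huS : u ∈ S := ⟨hau, le_rfl, hne⟩
  have hbdd : BddBelow S := ⟨a, fun t ht => ht.1.le⟩
  have hsu : sInf S ≤ u := csInf_le hbdd huS
  have hbelow : ∀ t : ℝ, a < t → t < sInf S → f t = v := by
    intro t hat hts
    by_contra h
    exact absurd (csInf_le hbdd ⟨hat, (hts.trans_le hsu).le, h⟩) (not_le.mpr hts)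
  obtain ⟨ε, hε, hεv⟩ := hr a ha
  have has : a < sInf S := by
    have : a + ε ≤ sInf S := by
      refine le_csInf ⟨u, huS⟩ fun t ht => ?_
      by_contra h
      exact ht.2.2 ((hεv t ht.1 (not_le.mp h)).trans hga)
    linarith
  have hfs : f (sInf S) = v := by
    obtain ⟨δ, hδ, -, hδv⟩ := hl (sInf S) (ha.trans_lt has)
    obtain ⟨t, ht, hts⟩ := exists_between (max_lt has (sub_lt_self (sInf S) hδ))
    rw [← hδv t ((le_max_right _ _).trans_lt ht) hts]
    exact hbelow t ((le_max_left _ _).trans_lt ht) hts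
  have hlt : sInf S < u := lt_of_le_of_ne hsu fun h => hne (h ▸ hfs)
  obtain ⟨δ, hδ, hδv⟩ := hr (sInf S) (ha.trans has.le)
  have hgs := hstep _ has hlt hfs
  have : sInf S + δ ≤ sInf S := by
    refine le_csInf ⟨u, huS⟩ fun t ht => ?_
    by_contra h
    rcases (csInf_le hbdd ht).eq_or_lt with h' | h'
    · exact ht.2.2 (h' ▸ hfs)
    · exact ht.2.2 ((hδv t h' (not_le.mp h)).trans hgs)
  linarith

namespace TrainMotion

variable {dmin dmax : ℝ} {f : ℝ → TStat} {tm : ℕ → EReal}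

theorem exists_real (h : TrainMotion dmin dmax f tm) {n : ℕ} (hn : tm n ≠ ⊤) :
    ∃ a : ℝ, 0 ≤ a ∧ tm n = (a : EReal) := by
  have h0 : 0 ≤ tm n := h.zero ▸ h.mono (Nat.zero_le n)
  lift tm n to ℝ using ⟨hn, (EReal.bot_lt_zero.trans_le h0).ne'⟩ with a
  exact ⟨a, by exact_mod_cast h0, rfl⟩

theorem nonneg (h : TrainMotion dmin dmax f tm) {n : ℕ} {a : ℝ} (ha : tm n = (a : EReal)) :
    0 ≤ a := by
  have h0 : 0 ≤ tm n := h.zero ▸ h.mono (Nat.zero_le n)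
  rw [ha] at h0
  exact_mod_cast h0

/-- A moment of becoming `coming` is followed by a moment of becoming `incrossing`. -/
theorem exists_crossing (h : TrainMotion dmin dmax f tm) {i : ℕ} {b : ℝ}
    (hb : tm (3 * i + 1) = (b : EReal)) :
    ∃ c : ℝ, tm (3 * i + 2) = (c : EReal) ∧ b + dmin ≤ c := by
  have hc : tm (3 * i + 2) ≠ ⊤ := fun hc => by
    have := h.last_div (3 * i + 1) (by simp [hb]) hc
    omega
  obtain ⟨c, -, hc⟩ := h.exists_real hc
  exact ⟨c, hc, by linarith [(h.gap i b c hb hc).1]⟩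

theorem mul_le (h : TrainMotion dmin dmax f tm) (i : ℕ) :
    ((i * dmin : ℝ) : EReal) ≤ tm (3 * i) := by
  induction i with
  | zero => simp [h.zero]
  | succ i ih =>
    by_cases htop : tm (3 * i + 1) = ⊤
    · have h3 : tm (3 * (i + 1)) = ⊤ :=
        top_le_iff.mp (htop ▸ h.mono (show 3 * i + 1 ≤ 3 * (i + 1) by omega))
      simp [h3]
    · obtain ⟨b, -, hb⟩ := h.exists_real htop
      obtain ⟨c, hc, hbc⟩ := h.exists_crossing hb
      have h1 : ((i * dmin : ℝ) : EReal) ≤ (b : EReal) :=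
        ih.trans (hb ▸ h.mono (Nat.le_succ _))
      have h2 : (c : EReal) ≤ tm (3 * (i + 1)) :=
        hc ▸ h.mono (show 3 * i + 2 ≤ 3 * (i + 1) by omega)
      refine le_trans ?_ h2
      rw [EReal.coe_le_coe_iff] at h1 ⊢
      push_cast
      linarith

/-- Positive time is covered by the intervals on which the track is empty and those on which
it is not. -/
theorem cover (h : TrainMotion dmin dmax f tm) (hdmin : 0 < dmin) {t : ℝ} (ht : 0 < t) :
    (∃ i : ℕ, ∃ a : ℝ, tm (3 * i) = (a : EReal) ∧ a < t ∧ (t : EReal) ≤ tm (3 * i + 1)) ∨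
      ∃ i : ℕ, ∃ b : ℝ, tm (3 * i + 1) = (b : EReal) ∧ b < t ∧ (t : EReal) ≤ tm (3 * i + 3) := by
  have hex : ∃ n, (t : EReal) ≤ tm n := by
    obtain ⟨i, hi⟩ := exists_nat_ge (t / dmin)
    refine ⟨3 * i, le_trans ?_ (h.mul_le i)⟩
    exact EReal.coe_le_coe_iff.mpr ((div_le_iff₀ hdmin).mp hi)
  have hspec := Nat.find_spec hex
  have hmin := fun m => Nat.find_min hex (m := m)
  generalize Nat.find hex = n at hspec hmin
  cases n with
  | zero =>
    rw [h.zero] at hspec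
    exact absurd (EReal.coe_nonpos.mp hspec) (not_le.mpr ht)
  | succ k =>
    have hk : ∀ m ≤ k, ∃ a : ℝ, tm m = (a : EReal) ∧ a < t := by
      intro m hm
      have hlt := not_le.mp (hmin m (by omega))
      obtain ⟨a, -, ha⟩ := h.exists_real hlt.ne_top
      exact ⟨a, ha, EReal.coe_lt_coe_iff.mp (ha ▸ hlt)⟩
    obtain ⟨i, rfl | rfl | rfl⟩ : ∃ i, k = 3 * i ∨ k = 3 * i + 1 ∨ k = 3 * i + 2 :=
      ⟨k / 3, by omega⟩
    · obtain ⟨a, ha, hat⟩ := hk _ le_rfl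
      exact Or.inl ⟨i, a, ha, hat, hspec⟩
    · obtain ⟨b, hb, hbt⟩ := hk _ le_rfl
      exact Or.inr ⟨i, b, hb, hbt, hspec.trans (h.mono (by omega))⟩
    · obtain ⟨b, hb, hbt⟩ := hk (3 * i + 1) (by omega)
      exact Or.inr ⟨i, b, hb, hbt, hspec⟩

theorem eq_emp (h : TrainMotion dmin dmax f tm) {i : ℕ} {a : ℝ} (ha : tm (3 * i) = (a : EReal)) :
    f a = TStat.emp :=
  h.status_empty i a ha.le (ha ▸ h.strict (3 * i) (by simp [ha]))

theorem eq_coming (h : TrainMotion dmin dmax f tm) {i : ℕ} {b : ℝ}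
    (hb : tm (3 * i + 1) = (b : EReal)) : f b = TStat.coming :=
  h.status_coming i b hb.le (hb ▸ h.strict (3 * i + 1) (by simp [hb]))

theorem ne_emp (h : TrainMotion dmin dmax f tm) {i : ℕ} {t : ℝ}
    (h1 : tm (3 * i + 1) ≤ (t : EReal)) (h3 : (t : EReal) < tm (3 * i + 3)) :
    f t ≠ TStat.emp := by
  rcases lt_or_ge (t : EReal) (tm (3 * i + 2)) with h2 | h2
  · simp [h.status_coming i t h1 h2]
  · simp [h.status_cross i t h2 h3]

end TrainMotion

namespace RegularRun

variable {Tracks : Type*} {dmin dmax dopen dclose : ℝ}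

theorem deadline_eq_top (R : RegularRun Tracks dmin dmax dopen dclose) {x : Tracks}
    {tm : ℕ → EReal} (h : TrainMotion dmin dmax (R.trackStatus x) tm) {i : ℕ} {a t : ℝ}
    (ha : tm (3 * i) = (a : EReal)) (hat : a < t) (ht : (t : EReal) ≤ tm (3 * i + 1)) :
    R.deadline x t = ⊤ := by
  have ha0 : 0 ≤ a := h.nonneg ha
  refine eq_of_rightVal_eq (R.dlPlus_spec x) (R.dl_left x) ha0 ?_ ?_ hat
  · by_cases hd : R.deadline x a = ⊤
    · rw [R.dl_step_other x a ha0 (by simp [h.eq_emp ha]) (by simp [hd]), hd]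
    · exact R.dl_step_empty x a ha0 (h.eq_emp ha) hd
  · intro s has hst hs
    have hemp : R.trackStatus x s = TStat.emp :=
      h.status_empty i s (ha ▸ (EReal.coe_lt_coe_iff.mpr has).le)
        ((EReal.coe_lt_coe_iff.mpr hst).trans_le ht)
    rw [R.dl_step_other x s (ha0.trans has.le) (by simp [hemp]) (by simp [hs]), hs]

theorem deadline_eq_top_of_coming (R : RegularRun Tracks dmin dmax dopen dclose) {x : Tracks}
    {tm : ℕ → EReal} (h : TrainMotion dmin dmax (R.trackStatus x) tm) {i : ℕ} {b : ℝ}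
    (hb : tm (3 * i + 1) = (b : EReal)) : R.deadline x b = ⊤ := by
  have hi : tm (3 * i) ≠ ⊤ := fun htop => by
    have := h.mono (Nat.le_succ (3 * i))
    simp [htop, hb] at this
  obtain ⟨a, -, ha⟩ := h.exists_real hi
  have hlt := h.strict (3 * i) hi
  rw [ha, hb, EReal.coe_lt_coe_iff] at hlt
  exact R.deadline_eq_top h ha hlt hb.ge

theorem deadlinePlus_of_coming (R : RegularRun Tracks dmin dmax dopen dclose) {x : Tracks}
    {tm : ℕ → EReal} (h : TrainMotion dmin dmax (R.trackStatus x) tm) {i : ℕ} {b : ℝ}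
    (hb : tm (3 * i + 1) = (b : EReal)) :
    R.deadlinePlus x b = ((b + (dmin - dclose) : ℝ) : EReal) :=
  R.dl_step_coming x b (h.nonneg hb) (h.eq_coming hb) (R.deadline_eq_top_of_coming h hb)

theorem deadline_eq_add (R : RegularRun Tracks dmin dmax dopen dclose) {x : Tracks}
    {tm : ℕ → EReal} (h : TrainMotion dmin dmax (R.trackStatus x) tm) {i : ℕ} {b t : ℝ}
    (hb : tm (3 * i + 1) = (b : EReal)) (hbt : b < t) (ht : (t : EReal) ≤ tm (3 * i + 3)) :
    R.deadline x t = ((b + (dmin - dclose) : ℝ) : EReal) := by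
  have hb0 : 0 ≤ b := h.nonneg hb
  refine eq_of_rightVal_eq (R.dlPlus_spec x) (R.dl_left x) hb0
    (R.deadlinePlus_of_coming h hb) ?_ hbt
  intro s hbs hst hs
  have hne : R.trackStatus x s ≠ TStat.emp :=
    h.ne_emp (hb ▸ (EReal.coe_lt_coe_iff.mpr hbs).le)
      ((EReal.coe_lt_coe_iff.mpr hst).trans_le ht)
  have hs' : R.deadline x s ≠ ⊤ := hs ▸ EReal.coe_ne_top _
  rw [R.dl_step_other x s (hb0.trans hbs.le) (by simp [hs']) (by simp [hne]), hs]

/-- At a positive time the deadline of a track is either infinite or was fixed when the last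
train appeared. -/
theorem deadline_cases (R : RegularRun Tracks dmin dmax dopen dclose) {x : Tracks}
    {tm : ℕ → EReal} (h : TrainMotion dmin dmax (R.trackStatus x) tm) (hdmin : 0 < dmin)
    {t : ℝ} (ht : 0 ≤ t) :
    (R.deadline x t = ⊤ ∧
        (R.trackStatus x t = TStat.emp ∨ ∃ i : ℕ, tm (3 * i + 1) = (t : EReal))) ∨
      ∃ i : ℕ, ∃ b : ℝ, tm (3 * i + 1) = (b : EReal) ∧ b < t ∧ (t : EReal) ≤ tm (3 * i + 3) ∧
        R.deadline x t = ((b + (dmin - dclose) : ℝ) : EReal) := by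
  rcases ht.eq_or_lt with rfl | ht
  · exact Or.inl ⟨R.dl_init x, Or.inl (h.eq_emp (i := 0) (by simp [h.zero]))⟩
  · rcases h.cover hdmin ht with ⟨i, a, ha, hat, hti⟩ | ⟨i, b, hb, hbt, hti⟩
    · refine Or.inl ⟨R.deadline_eq_top h ha hat hti, ?_⟩
      rcases hti.eq_or_lt with heq | hlt
      · exact Or.inr ⟨i, heq.symm⟩
      · exact Or.inl (h.status_empty i t (ha ▸ (EReal.coe_lt_coe_iff.mpr hat).le) hlt)
    · exact Or.inr ⟨i, b, hb, hbt, hti, R.deadline_eq_add h hb hbt hti⟩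

end RegularRun

theorem three_rules_corollary {Tracks : Type*} [Fintype Tracks] [Nonempty Tracks]
    {dmin dmax dopen dclose : ℝ}
    (hdmin : 0 < dmin) (hdmax : 0 < dmax) (hdopen : 0 < dopen) (hdclose : 0 < dclose)
    (hcm : dclose < dmin) (hmm : dmin ≤ dmax)
    (R : RegularRun Tracks dmin dmax dopen dclose)
    (x : Tracks) (tm : ℕ → EReal) (htm : TrainMotion dmin dmax (R.trackStatus x) tm) :
    (∀ t : ℝ, 0 ≤ t →
      ((R.deadlinePlus x t ≠ R.deadline x t ∧
          R.deadlinePlus x t = ((t + (dmin - dclose) : ℝ) : EReal)) ↔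
        ∃ i : ℕ, tm (3 * i + 1) = (t : EReal))) ∧
    (∀ t : ℝ, 0 ≤ t →
      (R.deadline x t = (t : EReal) ↔
        ∃ i : ℕ, ∃ a : ℝ, tm (3 * i + 1) = (a : EReal) ∧ t = a + (dmin - dclose))) ∧
    (∀ t : ℝ, 0 ≤ t →
      ((R.deadlinePlus x t ≠ R.deadline x t ∧ R.deadlinePlus x t = ⊤) ↔
        ∃ i : ℕ, 0 < i ∧ tm (3 * i) = (t : EReal))) := by
  refine ⟨fun t ht => ⟨?_, ?_⟩, fun t ht => ⟨?_, ?_⟩, fun t ht => ⟨?_, ?_⟩⟩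
  · rintro ⟨hne, heq⟩
    rcases R.deadline_cases htm hdmin ht with ⟨hd, hemp | hi⟩ | ⟨i, b, hb, hbt, hti, hd⟩
    · exact absurd (R.dl_step_other x t ht (by simp [hemp]) (by simp [hd])) hne
    · exact hi
    · have hd' : R.deadline x t ≠ ⊤ := hd ▸ EReal.coe_ne_top _
      by_cases hemp : R.trackStatus x t = TStat.emp
      · rw [R.dl_step_empty x t ht hemp hd'] at heq
        exact absurd heq.symm (EReal.coe_ne_top _)
      · exact absurd (R.dl_step_other x t ht (by simp [hd']) (by simp [hemp])) hne
  · rintro ⟨i, hi⟩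
    have hplus := R.deadlinePlus_of_coming htm hi
    refine ⟨?_, hplus⟩
    rw [hplus, R.deadline_eq_top_of_coming htm hi]
    exact EReal.coe_ne_top _
  · intro hdt
    rcases R.deadline_cases htm hdmin ht with ⟨hd, -⟩ | ⟨i, b, hb, -, -, hd⟩
    · exact absurd (hdt.symm.trans hd) (EReal.coe_ne_top _)
    · exact ⟨i, b, hb, EReal.coe_eq_coe_iff.mp (hdt.symm.trans hd)⟩
  · rintro ⟨i, b, hb, rfl⟩
    obtain ⟨c, hc, hbc⟩ := htm.exists_crossing hb
    refine R.deadline_eq_add htm hb (by linarith) ?_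
    refine le_trans ?_ (htm.mono (Nat.le_succ (3 * i + 2)))
    rw [hc, EReal.coe_le_coe_iff]
    linarith
  · rintro ⟨hne, heq⟩
    rcases R.deadline_cases htm hdmin ht with ⟨hd, -⟩ | ⟨i, b, hb, hbt, hti, hd⟩
    · exact absurd (heq.trans hd.symm) hne
    · refine ⟨i + 1, Nat.succ_pos i, ?_⟩
      rcases hti.eq_or_lt with h | h
      · exact h.symm
      · have hd' : R.deadline x t ≠ ⊤ := hd ▸ EReal.coe_ne_top _
        have hemp := htm.ne_emp (hb ▸ (EReal.coe_lt_coe_iff.mpr hbt).le) h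
        exact absurd (R.dl_step_other x t ht (by simp [hd']) (by simp [hemp])) hne
  · rintro ⟨i, hi, hit⟩
    obtain ⟨j, rfl⟩ := Nat.exists_eq_succ_of_ne_zero hi.ne'
    have hle : tm (3 * j + 1) ≤ (t : EReal) := hit ▸ htm.mono (by omega)
    obtain ⟨b, -, hb⟩ := htm.exists_real (hle.trans_lt (EReal.coe_lt_top t)).ne
    have hlt : b < t := by
      rw [← EReal.coe_lt_coe_iff, ← hb, ← hit]
      exact (htm.strict _ (by simp [hb])).trans_le (htm.mono (by omega))
    have hd : R.deadline x t ≠ ⊤ :=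
      R.deadline_eq_add htm hb hlt hit.ge ▸ EReal.coe_ne_top _
    have hplus := R.dl_step_empty x t ht (htm.eq_emp hit) hd
    exact ⟨hplus ▸ hd.symm, hplus⟩

end RailCross
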